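/- Suppose the free group F₂ splits as a proper amalgamated product A ∗_C B with C infinite cyclic. Then there exist elements x, y ∈ F₂ and an integer n > 1 such that F₂ is generated by {x, y} and, after possibly exchanging A and B, A = ⟨x⟩ (infinite cyclic), B = ⟨x^n, y⟩ (free of rank 2), and C = ⟨x^n⟩. In particular C is malnormal in B. -/

import Mathlib

/-- The two-element family of subgroups `A`, `B`. -/
def amalgFam {G : Type*} [Group G] (A B : Subgroup G) : Bool → Subgroup G :=
  fun b => bif b then A else B

theorem inf_le_amalgFam {G : Type*} [Group G] (A B : Subgroup G) (b : Bool) :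
    A ⊓ B ≤ amalgFam A B b := by
  cases b
  · exact inf_le_right
  · exact inf_le_left

/-- The diagram of inclusions `A ∩ B ↪ A`, `A ∩ B ↪ B`. -/
def amalgMaps {G : Type*} [Group G] (A B : Subgroup G) :
    ∀ b : Bool, ↥(A ⊓ B) →* ↥(amalgFam A B b) :=
  fun b => Subgroup.inclusion (inf_le_amalgFam A B b)

/-- The canonical homomorphism from the amalgamated free product (pushout) of the
inclusions `A ∩ B ↪ A` and `A ∩ B ↪ B` back to `G`. -/
def amalgToGroup {G : Type*} [Group G] (A B : Subgroup G) :
    Monoid.PushoutI (amalgMaps A B) →* G :=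
  Monoid.PushoutI.lift (fun b => (amalgFam A B b).subtype) (A ⊓ B).subtype
    (fun b => by ext x; rfl)

/-- `G` splits as a proper amalgamated product `A ∗_{A ∩ B} B`. -/
def SplitsAsAmalgam {G : Type*} [Group G] (A B : Subgroup G) : Prop :=
  A ≠ A ⊓ B ∧ B ≠ A ⊓ B ∧ Function.Bijective (amalgToGroup A B)

/-- A subgroup `C` of `G` is malnormal if `gCg⁻¹ ∩ C = 1` for all `g ∉ C`. -/
def IsMalnormal {G : Type*} [Group G] (C : Subgroup G) : Prop :=
  ∀ g : G, g ∉ C → ∀ c ∈ C, g * c * g⁻¹ ∈ C → c = 1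

/-- A subgroup `C` is malnormal in the subgroup `D` if `gCg⁻¹ ∩ C = 1` for all `g ∈ D`,
`g ∉ C`. -/
def IsMalnormalIn {G : Type*} [Group G] (C D : Subgroup G) : Prop :=
  ∀ g ∈ D, g ∉ C → ∀ c ∈ C, g * c * g⁻¹ ∈ C → c = 1


/-- Homomorphisms out of `A` and `B` that agree on `A ∩ B` extend to `G`. -/
def HasAmalgamLift {G : Type} [Group G] (A B : Subgroup G) : Prop :=
  ∀ (H : Type) [Group H] (f : A →* H) (g : B →* H),
    (∀ x (ha : x ∈ A) (hb : x ∈ B), f ⟨x, ha⟩ = g ⟨x, hb⟩) →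
    ∃ h : G →* H, (∀ a : A, h a = f a) ∧ ∀ b : B, h b = g b

theorem HasAmalgamLift.symm {G : Type} [Group G] {A B : Subgroup G} (h : HasAmalgamLift A B) :
    HasAmalgamLift B A := by
  intro H _ f g hfg
  obtain ⟨k, hA, hB⟩ := h H g f fun x ha hb => (hfg x hb ha).symm
  exact ⟨k, hB, hA⟩

theorem HasAmalgamLift.exists_lift_con {α : Type} {A B : Subgroup (FreeGroup α)}
    (h : HasAmalgamLift A B) {W : Type} [Group W] (r : Con W) (f : A →* W) (g : B →* W)
    (hfg : ∀ x (ha : x ∈ A) (hb : x ∈ B), r (f ⟨x, ha⟩) (g ⟨x, hb⟩)) :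
    ∃ ψ : FreeGroup α →* W, (∀ a : A, r (ψ a) (f a)) ∧ ∀ b : B, r (ψ b) (g b) := by
  obtain ⟨k, hA, hB⟩ := h r.Quotient (r.mk'.comp f) (r.mk'.comp g)
    fun x ha hb => r.eq.2 (hfg x ha hb)
  choose s hs using fun i => Quot.exists_rep (k (FreeGroup.of i))
  have hk : r.mk'.comp (FreeGroup.lift s) = k := by
    ext i
    rw [MonoidHom.comp_apply, FreeGroup.lift_apply_of]
    exact hs i
  refine ⟨FreeGroup.lift s, fun a => r.eq.1 ?_, fun b => r.eq.1 ?_⟩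
  · exact (DFunLike.congr_fun hk (a : FreeGroup α)).trans (hA a)
  · exact (DFunLike.congr_fun hk (b : FreeGroup α)).trans (hB b)

/-- `E` is almost invariant under `G`, and along the orbits of `c` it only changes
between `c⁻¹` and `1`. -/
structure SplitsOrbit {G X : Type*} [Group G] (E : G → X) (c : G) : Prop where
  eq_iff : ∀ y, E (c⁻¹ * y) = E y ↔ y ≠ 1
  finite : ∀ b, {y | E (b⁻¹ * y) ≠ E y}.Finite

/-- A permutation of `n` copies of `G` whose `n`-th power is multiplication by `c`. -/
def rootPerm {G : Type} [Group G] (c : G) (n : ℕ) (hn : 1 < n) : Equiv.Perm (Fin n × G) where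
  toFun p := if h : p.1.val + 1 < n then (⟨p.1 + 1, h⟩, p.2) else (⟨0, by lia⟩, c * p.2)
  invFun p := if p.1.val = 0 then (⟨n - 1, by lia⟩, c⁻¹ * p.2) else (⟨p.1 - 1, by lia⟩, p.2)
  left_inv p := by
    obtain ⟨⟨i, hi⟩, y⟩ := p
    by_cases h : i + 1 < n
    · simp [h]
    · simp only [h, dite_false, if_true, inv_mul_cancel_left]
      congr
      lia
  right_inv p := by
    obtain ⟨⟨i, hi⟩, y⟩ := p
    by_cases h : i = 0
    · subst h
      simp [show ¬ (n - 1 + 1 < n) by lia]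
    · simp only [h, if_false, dite_true, show i - 1 + 1 < n by lia]
      congr
      lia

theorem rootPerm_pow_apply {G : Type} [Group G] (c : G) (n : ℕ) (hn : 1 < n) (k : ℕ) (hk : k ≤ n)
    (i : Fin n) (y : G) :
    (rootPerm c n hn ^ k) (i, y) =
      if h : i.val + k < n then (⟨i + k, h⟩, y) else (⟨i + k - n, by lia⟩, c * y) := by
  induction k with
  | zero => simp
  | succ k ih =>
    rw [pow_succ', Equiv.Perm.mul_apply, ih (by lia)]
    by_cases h : i.val + k < n
    · by_cases h' : i.val + k + 1 < n
      · simp [h, h', rootPerm, ← add_assoc]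
      · simp only [h, dite_true, rootPerm, Equiv.coe_fn_mk, h', dite_false, ← add_assoc]
        exact Prod.ext (Fin.ext (show 0 = i.val + k + 1 - n by lia)) rfl
    · simp only [h, dite_false, rootPerm, Equiv.coe_fn_mk, ← add_assoc,
        show i.val + k - n + 1 < n by lia, dite_true, show ¬ (i.val + k + 1 < n) by lia]
      congr
      lia

theorem rootPerm_pow {G : Type} [Group G] (c : G) (n : ℕ) (hn : 1 < n) (i : Fin n) (y : G) :
    (rootPerm c n hn ^ n) (i, y) = (i, c * y) := by
  rw [rootPerm_pow_apply c n hn n le_rfl]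
  simp

/-- Left multiplication on the copies of `G`. -/
def sliceMul (G : Type) [Group G] (I : Type) : G →* Equiv.Perm (I × G) where
  toFun b := (Equiv.refl I).prodCongr (Equiv.mulLeft b)
  map_one' := by ext <;> simp
  map_mul' a b := by ext <;> simp [mul_assoc]

@[simp]
theorem sliceMul_apply {G : Type} [Group G] {I : Type} (b : G) (i : I) (y : G) :
    sliceMul G I b (i, y) = (i, b * y) := rfl

@[simp]
theorem sliceMul_symm_apply {G : Type} [Group G] {I : Type} (b : G) (i : I) (y : G) :
    (sliceMul G I b).symm (i, y) = (i, b⁻¹ * y) := rfl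

/-- The congruence on signed permutations that ignores finitely many signs. -/
def finiteSignCon (Ω : Type) : Con ((Ω → ℤˣ) ⋊[mulAutArrow] Equiv.Perm Ω) where
  r w w' := w.right = w'.right ∧ {ω | w.left ω ≠ w'.left ω}.Finite
  iseqv := by
    refine ⟨fun w => ⟨rfl, by simp⟩, fun h => ⟨h.1.symm, by simpa only [ne_comm] using h.2⟩,
      fun h h' => ⟨h.1.trans h'.1, (h.2.union h'.2).subset fun ω hω => ?_⟩⟩
    by_contra hc
    simp only [Set.mem_union, Set.mem_ofPred_eq, not_or, not_not] at hc hω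
    exact hω (hc.1.trans hc.2)
  mul' := by
    rintro a b c d ⟨h1, h2⟩ ⟨h3, h4⟩
    refine ⟨by simp [h1, h3], (h2.union (h4.image a.right)).subset fun ω hω => ?_⟩
    by_contra hc
    simp only [Set.mem_union, Set.mem_ofPred_eq, not_or, not_not, Set.mem_image, not_exists,
      not_and'] at hc hω
    apply hω
    have := hc.2 (a.right⁻¹ ω) (by simp)
    simp only [SemidirectProduct.mul_left, Pi.mul_apply, hc.1, mulAutArrow_apply_apply, ← h1]
    congr 1

theorem units_eq_iff_of_mul_eq {t t' v v' u u' s s' : ℤˣ}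
    (h : u * (t * t') = v * v' * u') :
    t' * s' * v' * u' = t * s * v * u ↔ s' = s := by
  have key : t' * v' * u' = t * v * u := by
    calc t' * v' * u' = (v * v) * (t' * v' * u') := by rw [Int.units_mul_self, one_mul]
      _ = t' * v * (v * v' * u') := by ac_rfl
      _ = (t' * t') * (t * v * u) := by rw [← h]; ac_rfl
      _ = t * v * u := by rw [Int.units_mul_self, one_mul]
  rw [mul_right_comm t' s', mul_right_comm (t' * v') s', key, mul_right_comm t s,
    mul_right_comm (t * v) s, mul_right_inj]

theorem units_eq_of_mul_eq {t t' v v' s s' : ℤˣ} (h : t * t' = s * s'⁻¹) (h' : v * v' = 1 * 1⁻¹) :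
    t' * s' * v' * 1 = t * s * v * 1 := by
  have key : ∀ {a b c d : ℤˣ}, a * b = c * d⁻¹ → b * d = a * c := by decide
  rw [key h, mul_one, mul_one, ← mul_one v', key h', mul_one]

theorem exists_splitsOrbit {α : Type} {A B : Subgroup (FreeGroup α)} (h : HasAmalgamLift A B)
    (x : A) (hx : ∀ (H : Type) [Group H] (σ : H), ∃ f : A →* H, f x = σ)
    (c : B) (hc : ∀ k : ℕ, c ^ (k + 1) ≠ 1) (n : ℕ) (hn : 1 < n)
    (hxc : (x : FreeGroup α) ^ n = c) (hAB : A ⊓ B = Subgroup.zpowers (c : FreeGroup α)) :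
    ∃ E : B → ℤˣ, SplitsOrbit E c := by
  classical
  let W := ((Fin n × B → ℤˣ) ⋊[mulAutArrow] Equiv.Perm (Fin n × B))
  let i₀ : Fin n := ⟨0, by lia⟩
  let i₁ : Fin n := ⟨1, hn⟩
  have hi : i₁ ≠ i₀ := by simp [i₀, i₁]
  have hσ : ∀ y, rootPerm c n hn (i₀, y) = (i₁, y) := fun y => by simp [rootPerm, i₀, i₁, hn]
  let S₀ : B → ℤˣ := fun y => if ∃ k : ℕ, y = c ^ k then -1 else 1
  have hS₀ : ∀ y, S₀ (c⁻¹ * y) = S₀ y ↔ y ≠ 1 := by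
    intro y
    by_cases h1 : y = 1
    · have : ¬ ∃ k : ℕ, c⁻¹ = c ^ k := by
        rintro ⟨k, hk⟩
        exact hc k (by rw [pow_succ, ← hk, inv_mul_cancel])
      have h0 : ∃ k : ℕ, 1 = c ^ k := ⟨0, by simp⟩
      simp only [h1, mul_one, S₀, this, h0, if_true, if_false]
      simp only [ne_eq, not_true_eq_false, iff_false]
      decide
    · have : (∃ k : ℕ, c⁻¹ * y = c ^ k) ↔ ∃ k : ℕ, y = c ^ k := by
        constructor
        · rintro ⟨k, hk⟩
          exact ⟨k + 1, by rw [pow_succ', ← hk, mul_inv_cancel_left]⟩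
        · rintro ⟨k | k, hk⟩
          · simp [h1] at hk
          · exact ⟨k, by rw [hk, pow_succ', inv_mul_cancel_left]⟩
      simp [S₀, this, h1]
  let S : Fin n × B → ℤˣ := fun p => if p.1 = i₀ then S₀ p.2 else 1
  obtain ⟨f, hf⟩ := hx W (SemidirectProduct.inr (rootPerm c n hn))
  let g : B →* W := (MulAut.conj (SemidirectProduct.inl S : W)).toMonoidHom.comp
    (SemidirectProduct.inr.comp (sliceMul B (Fin n)))
  have hgr : ∀ b, (g b).right = sliceMul B (Fin n) b := fun b => by simp [g]
  have hgl : ∀ b i y, (g b).left (i, y) = S (i, y) * (S (i, b⁻¹ * y))⁻¹ := fun b i y => by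
    simp [g]
    rfl
  have hxn : x ^ n = ⟨c, (hAB.ge (Subgroup.mem_zpowers _)).1⟩ := Subtype.ext (by simpa using hxc)
  have hfg : ∀ y (ha : y ∈ A) (hb : y ∈ B), finiteSignCon _ (f ⟨y, ha⟩) (g ⟨y, hb⟩) := by
    intro y ha hb
    obtain ⟨k, rfl⟩ := Subgroup.mem_zpowers_iff.1 (hAB.le ⟨ha, hb⟩)
    have e1 : (⟨(c : FreeGroup α) ^ k, ha⟩ : A) = (x ^ n) ^ k := by
      rw [hxn]; rfl
    have e2 : (⟨(c : FreeGroup α) ^ k, hb⟩ : B) = c ^ k := rfl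
    rw [e1, e2, map_zpow f, map_zpow g]
    refine (finiteSignCon _).zpow k ?_
    rw [map_pow, hf, ← map_pow]
    refine ⟨?_, (Set.finite_singleton (i₀, (1 : B))).subset ?_⟩
    · rw [hgr]
      ext1 ⟨i, y⟩
      exact rootPerm_pow c n hn i y
    · rintro ⟨i, y⟩ hy
      simp only [Set.mem_ofPred_eq, hgl, SemidirectProduct.left_inr, Pi.one_apply] at hy
      by_cases h0 : i = i₀
      · subst h0
        by_contra hne
        have : S₀ (c⁻¹ * y) = S₀ y := (hS₀ y).2 fun h => hne (by simp [h])
        simp [S, this] at hy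
      · simp [S, h0] at hy
  obtain ⟨ψ, hψA, hψB⟩ := h.exists_lift_con (finiteSignCon (Fin n × B)) f g hfg
  have hbr : ∀ b : B, (ψ b).right = sliceMul B (Fin n) b := fun b => (hψB b).1.trans (hgr b)
  have hxr : (ψ x).right = rootPerm c n hn := by
    rw [(hψA x).1, hf]; rfl
  have hmul : ∀ (b b' : B) i y,
      (ψ (b * b')).left (i, y) = (ψ b).left (i, y) * (ψ b').left (i, b⁻¹ * y) := by
    intro b b' i y
    rw [map_mul, SemidirectProduct.mul_left, hbr]
    rfl
  let T : Fin n → B → ℤˣ := fun i y => (ψ y).left (i, y)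
  have hT : ∀ (b : B) i y, (ψ b).left (i, y) = T i y * T i (b⁻¹ * y) := by
    intro b i y
    have := hmul b (b⁻¹ * y) i y
    simp only [Subgroup.coe_mul, Subgroup.coe_inv, mul_inv_cancel_left] at this
    simp only [T, this, Subgroup.coe_mul, Subgroup.coe_inv, mul_assoc, Int.units_mul_self, mul_one]
  let u : B → ℤˣ := fun y => (ψ x).left (i₁, y)
  have hu : {y | u y ≠ 1}.Finite := by
    have := (hψA x).2
    rw [hf] at this
    exact this.preimage (f := fun y => (i₁, y)) fun _ _ _ _ h => congrArg Prod.snd h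
  have hcomm : ∀ y, u y * (ψ c).left (i₀, y) = (ψ c).left (i₁, y) * u (c⁻¹ * y) := by
    intro y
    have e : (x : FreeGroup α) * c = c * x := by rw [← hxc, ← pow_succ', pow_succ]
    have := congrArg (fun w : W => w.left (i₁, y)) ((map_mul ψ _ _).symm.trans
      ((congrArg ψ e).trans (map_mul ψ _ _)))
    simp only [SemidirectProduct.mul_left, Pi.mul_apply, hbr, hxr] at this
    have h2 : ((rootPerm c n hn)⁻¹ : Equiv.Perm _) (i₁, y) = (i₀, y) := by
      rw [Equiv.Perm.inv_eq_iff_eq, hσ]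
    refine Eq.trans ?_ this
    simp only [u, mulAutArrow_apply_apply]
    congr 1
  refine ⟨fun y => T i₀ y * S₀ y * T i₁ y * u y, fun y => ?_, fun b => ?_⟩
  · have h1 := hcomm y
    rw [hT, hT] at h1
    rw [← hS₀ y]
    exact units_eq_iff_of_mul_eq h1
  · have hfin : ∀ i, {y | (ψ b).left (i, y) ≠ (g b).left (i, y)}.Finite := fun i =>
      (hψB b).2.preimage (f := fun y => (i, y)) fun _ _ _ _ h => congrArg Prod.snd h
    refine (((hfin i₀).union (hfin i₁)).union
      (hu.union (hu.preimage (f := fun y => b⁻¹ * y) (by simp)))).subset fun y hy => ?_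
    by_contra hcon
    simp only [Set.mem_union, Set.mem_ofPred_eq, Set.mem_preimage, not_or, not_not] at hcon
    obtain ⟨⟨h0, h1⟩, h2, h3⟩ := hcon
    rw [hgl, hT] at h0 h1
    simp only [S, hi, if_true, if_false] at h0 h1
    apply hy
    simp only [h2, h3]
    exact units_eq_of_mul_eq h0 h1

namespace SplitsOrbit

variable {G H X : Type*} [Group G] [Group H] {E : G → X} {c : G}

theorem zpow_mul_eq (h : SplitsOrbit E c) {y : G} (hy : y ∉ Subgroup.zpowers c) (k : ℤ) :
    E (c ^ k * y) = E y := by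
  have key : ∀ j : ℤ, E (c ^ j * y) = E (c ^ (j + 1) * y) := by
    intro j
    have hne : c ^ (j + 1) * y ≠ 1 := fun he => hy
      (Subgroup.mem_zpowers_iff.2 ⟨-(j + 1), by rw [zpow_neg, eq_inv_of_mul_eq_one_right he]⟩)
    rw [← (h.eq_iff _).2 hne, ← mul_assoc, zpow_add_one, (Commute.refl c).zpow_left j |>.eq,
      inv_mul_cancel_left]
  induction k using Int.induction_on with
  | zero => simp
  | succ i ih => rw [← key, ih]
  | pred i ih => rw [key, sub_add_cancel, ih]

theorem pow_eq (h : SplitsOrbit E c) (hinj : ∀ k : ℕ, c ^ (k + 1) ≠ 1) (k : ℕ) :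
    E (c ^ k) = E 1 := by
  induction k with
  | zero => simp
  | succ k ih => rw [← (h.eq_iff _).2 (hinj k), pow_succ', inv_mul_cancel_left, ih]

theorem pow_succ_ne_one (h : SplitsOrbit E c) (k : ℕ) : c ^ (k + 1) ≠ 1 := by
  induction k using Nat.strong_induction_on with
  | _ k ih =>
  intro hk
  have key : ∀ j ≤ k, E (c ^ j) = E 1 := by
    intro j hj
    induction j with
    | zero => simp
    | succ j ih' =>
      rw [← (h.eq_iff _).2 (ih j hj), pow_succ', inv_mul_cancel_left, ih' (by lia)]
  have h1 := (h.eq_iff 1).not_left.2 rfl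
  apply h1
  rw [mul_one, ← key k le_rfl, ← eq_inv_of_mul_eq_one_left ((pow_succ c k).symm.trans hk)]

theorem neg_pow_eq (h : SplitsOrbit E c) (k : ℕ) : E (c⁻¹ ^ (k + 1)) = E c⁻¹ := by
  induction k with
  | zero => simp
  | succ k ih =>
    rw [pow_succ', (h.eq_iff _).2, ih]
    rw [inv_pow, ne_eq, inv_eq_one]
    exact h.pow_succ_ne_one k

theorem inv_ne_one (h : SplitsOrbit E c) : E c⁻¹ ≠ E 1 := by
  have := (h.eq_iff 1).not_left.2 rfl
  rwa [mul_one] at this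

theorem zpow_injective (h : SplitsOrbit E c) : Function.Injective (fun k : ℤ => c ^ k) := by
  refine injective_zpow_iff_not_isOfFinOrder.2 fun hfin => ?_
  obtain ⟨n, hn, hc⟩ := isOfFinOrder_iff_pow_eq_one.1 hfin
  obtain ⟨k, rfl⟩ := Nat.exists_eq_succ_of_ne_zero hn.ne'
  exact h.pow_succ_ne_one k hc

/-- Far out along an orbit of powers of `d`, the function `E` does not see a multiplication
by `b`. -/
theorem exists_pow_mul_eq (h : SplitsOrbit E c) (b d y : G)
    (hd : Function.Injective (fun k : ℤ => d ^ k)) :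
    ∃ k : ℕ, k ≠ 0 ∧ E (b * (d ^ k * y)) = E (d ^ k * y) ∧
      E (b * (d⁻¹ ^ k * y)) = E (d⁻¹ ^ k * y) := by
  have hfin := h.finite b⁻¹
  rw [inv_inv] at hfin
  have h1 : Function.Injective fun k : ℕ => d ^ k * y := fun i j hij => by
    have := hd (a₁ := i) (a₂ := j) (by simpa using hij)
    exact_mod_cast this
  have h2 : Function.Injective fun k : ℕ => d⁻¹ ^ k * y := fun i j hij => by
    have := hd (a₁ := i) (a₂ := j) (by simpa using hij)
    exact_mod_cast this
  obtain ⟨k, hk⟩ := ((hfin.preimage h1.injOn).union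
    ((hfin.preimage h2.injOn).union (Set.finite_singleton 0))).exists_notMem
  simp only [Set.mem_union, Set.mem_preimage, Set.mem_ofPred_eq, Set.mem_singleton_iff, not_or,
    not_not] at hk
  exact ⟨k, hk.2.2, hk.1, hk.2.1⟩

theorem mem_zpowers_of_conj (h : SplitsOrbit E c) {g : G} {k m : ℤ} (hk : k ≠ 0)
    (hg : g * c ^ k * g⁻¹ = c ^ m) : g ∈ Subgroup.zpowers c := by
  by_contra hgc
  have hd : Function.Injective (fun j : ℤ => (c ^ k) ^ j) := fun i j hij => by
    simp only [← zpow_mul] at hij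
    exact mul_left_cancel₀ hk (h.zpow_injective hij)
  obtain ⟨j, hj, h1, h2⟩ := h.exists_pow_mul_eq g (c ^ k) 1 hd
  simp only [mul_one] at h1 h2
  have hconj : ∀ i : ℤ, E (g * (c ^ k) ^ i) = E g := fun i => by
    have : g * (c ^ k) ^ i = c ^ (m * i) * g := by
      rw [zpow_mul, ← hg, conj_zpow, inv_mul_cancel_right]
    rw [this, h.zpow_mul_eq hgc]
  have h3 := hconj j
  have h4 := hconj (-j)
  rw [zpow_natCast, h1] at h3
  rw [zpow_neg, ← inv_zpow, zpow_natCast, h2] at h4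
  have h5 := h3.trans h4.symm
  have hpos : ∀ i : ℕ, E (c ^ i) = E 1 := h.pow_eq h.pow_succ_ne_one
  rcases Int.eq_nat_or_neg k with ⟨i, rfl | rfl⟩
  · obtain ⟨l, hl⟩ := Nat.exists_eq_succ_of_ne_zero
      (mul_ne_zero (Int.natCast_ne_zero.1 hk) hj)
    simp only [zpow_natCast, ← inv_pow, ← pow_mul, hl, hpos, h.neg_pow_eq] at h5
    exact h.inv_ne_one h5.symm
  · obtain ⟨l, hl⟩ := Nat.exists_eq_succ_of_ne_zero
      (show i * j ≠ 0 from mul_ne_zero (fun h0 : i = 0 => hk (by simp [h0])) hj)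
    simp only [zpow_neg, zpow_natCast, ← inv_pow, inv_inv, ← pow_mul, hl, hpos,
      h.neg_pow_eq] at h5
    exact h.inv_ne_one h5

theorem comp_mulEquiv (h : SplitsOrbit E c) (φ : H ≃* G) : SplitsOrbit (E ∘ φ) (φ.symm c) where
  eq_iff y := by simpa using h.eq_iff (φ y)
  finite b := by simpa using (h.finite (φ b)).preimage φ.injective.injOn

theorem isMalnormalIn_aux (h : SplitsOrbit E c) {g d : G} (hg : g ∉ Subgroup.zpowers c)
    (hd : d ∈ Subgroup.zpowers c) (hgd : g * d * g⁻¹ ∈ Subgroup.zpowers c) : d = 1 := by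
  obtain ⟨k, rfl⟩ := Subgroup.mem_zpowers_iff.1 hd
  obtain ⟨m, hm⟩ := Subgroup.mem_zpowers_iff.1 hgd
  by_cases hk : k = 0
  · simp [hk]
  · exact absurd (h.mem_zpowers_of_conj hk hm.symm) hg

end SplitsOrbit

namespace FreeGroup

variable {α : Type*}

/-- The inverse letter. -/
def bar (s : α × Bool) : α × Bool := (s.1, !s.2)

theorem bar_bar (s : α × Bool) : bar (bar s) = s := by simp [bar]

theorem bar_eq_iff {s t : α × Bool} : bar s = t ↔ s = bar t := by
  constructor <;> rintro rfl <;> simp [bar_bar]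

theorem isReduced_cons_cons_iff {a b : α × Bool} {L : List (α × Bool)} :
    IsReduced (a :: b :: L) ↔ a ≠ bar b ∧ IsReduced (b :: L) := by
  rw [isReduced_cons_cons]
  refine and_congr_left fun _ => ?_
  obtain ⟨a, ⟨⟩ | ⟨⟩⟩ := a <;> obtain ⟨b, ⟨⟩ | ⟨⟩⟩ := b <;> simp [bar]

theorem IsReduced.eq_of_mk_eq {L M : List (α × Bool)} (hL : IsReduced L) (hM : IsReduced M)
    (h : mk L = mk M) : L = M := by
  classical
  rw [← hL.reduce_eq, ← hM.reduce_eq, reduce.sound h]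

theorem IsReduced.mk_ne_one {L : List (α × Bool)} (hL : IsReduced L) (h : L ≠ []) :
    mk L ≠ 1 := fun he => h (hL.eq_of_mk_eq .nil he)

theorem mk_flatten_replicate (L : List (α × Bool)) (k : ℕ) :
    mk (List.replicate k L).flatten = mk L ^ k := by
  induction k with
  | zero => rfl
  | succ k ih => rw [List.replicate_succ, List.flatten_cons, ← mul_mk, ih, pow_succ']

theorem length_flatten_replicate (L : List (α × Bool)) (k : ℕ) :
    (List.replicate k L).flatten.length = k * L.length := by
  simp

theorem IsCyclicallyReduced.swap {p q : List (α × Bool)} (h : IsCyclicallyReduced (p ++ q)) :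
    IsCyclicallyReduced (q ++ p) := by
  refine ⟨?_, ?_⟩
  · refine (h.flatten_replicate 2).isReduced.infix ⟨p, q, ?_⟩
    simp [List.replicate_succ]
  · have h1 := h.isReduced
    have h2 := h.2
    rcases eq_or_ne p [] with rfl | hp
    · simpa using h2
    rcases eq_or_ne q [] with rfl | hq
    · simpa using h2
    rw [List.getLast?_append_of_ne_nil _ hp, List.head?_append_of_ne_nil _ hq]
    exact (List.isChain_append.1 h1).2.2

theorem IsReduced.invRev {L : List (α × Bool)} (h : IsReduced L) : IsReduced (invRev L) := by
  classical
  rw [isReduced_iff_reduce_eq, reduce_invRev, h.reduce_eq]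

theorem IsCyclicallyReduced.invRev {L : List (α × Bool)} (h : IsCyclicallyReduced L) :
    IsCyclicallyReduced (invRev L) := by
  refine ⟨h.1.invRev, ?_⟩
  intro a ha b hb
  simp only [FreeGroup.invRev, List.getLast?_reverse, List.head?_map, List.head?_reverse,
    List.getLast?_map, Option.mem_def, Option.map_eq_some_iff] at ha hb
  obtain ⟨a, ha, rfl⟩ := ha
  obtain ⟨b, hb, rfl⟩ := hb
  intro hab
  simpa using (h.2 b hb a ha hab.symm).symm

theorem getLast?_invRev {L : List (α × Bool)} {z : α × Bool} (h : L.head? = some z) :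
    (invRev L).getLast? = some (bar z) := by
  simp [FreeGroup.invRev, List.getLast?_reverse, h, bar]

theorem IsCyclicallyReduced.isReduced_flatten_append {L l : List (α × Bool)} {y : α × Bool}
    (hL : IsCyclicallyReduced L) (hy : L.getLast? = some y) (hl : IsReduced (y :: l)) {k : ℕ}
    (hk : k ≠ 0) : IsReduced ((List.replicate k L).flatten ++ l) := by
  obtain ⟨M, rfl⟩ := List.getLast?_eq_some_iff.1 hy
  have := IsReduced.append_flatten_replicate_append (L₁ := []) (L₃ := l) hL
    (by simpa using IsReduced.append_overlap (L₃ := l) hL.isReduced hl (by simp)) hk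
  simpa using this

/-- `E` is constant on the cones of words of length `R`. -/
def ConeConst {X : Type*} (E : FreeGroup α → X) (R : ℕ) : Prop :=
  ∀ s l, IsReduced (s :: l) → R ≤ l.length → E (mk (s :: l)) = E (mk l)

theorem ConeConst.append {X : Type*} {E : FreeGroup α → X} {R : ℕ} (h : ConeConst E R)
    {w l : List (α × Bool)} (hwl : IsReduced (w ++ l)) (hl : R ≤ l.length) :
    E (mk (w ++ l)) = E (mk l) := by
  induction w with
  | nil => rfl
  | cons s w ih =>
    exact (h s (w ++ l) hwl (by simp; lia)).trans (ih (hwl.infix ⟨[s], [], by simp⟩))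

theorem exists_coneConst [Finite α] {X : Type*} {E : FreeGroup α → X}
    (h : ∀ b, {y | E (b⁻¹ * y) ≠ E y}.Finite) : ∃ R, ConeConst E R := by
  classical
  have hfin : (⋃ s : α × Bool, {y | E (mk [s] * y) ≠ E y}).Finite :=
    Set.finite_iUnion fun s => by simpa using h (mk [s])⁻¹
  obtain ⟨R, hR⟩ := (hfin.image norm).bddAbove
  refine ⟨R + 1, fun s l hsl hl => ?_⟩
  by_contra hne
  have h1 : norm (mk l) ≤ R := hR ⟨mk l, Set.mem_iUnion.2 ⟨s, by simpa [mul_mk] using hne⟩, rfl⟩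
  rw [norm, toWord_mk, (hsl.infix ⟨[s], [], by simp⟩ : IsReduced l).reduce_eq] at h1
  lia

theorem ConeConst.pow_mul {X : Type*} {E : FreeGroup α → X} {L l : List (α × Bool)}
    (h : ConeConst E (l.length + 1)) (hL : IsCyclicallyReduced L) {y : α × Bool}
    (hy : L.getLast? = some y) (hl : IsReduced (y :: l)) {k : ℕ} (hk : k ≠ 0) :
    E (mk L ^ k * mk l) = E (mk (y :: l)) := by
  have h1 := hL.isReduced_flatten_append hy hl hk
  rw [← mk_flatten_replicate, mul_mk]
  obtain ⟨k, rfl⟩ := Nat.exists_eq_succ_of_ne_zero hk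
  obtain ⟨M, rfl⟩ := List.getLast?_eq_some_iff.1 hy
  have h2 : (List.replicate (k + 1) (M ++ [y])).flatten ++ l =
      ((List.replicate k (M ++ [y])).flatten ++ M) ++ y :: l := by
    simp [List.replicate_succ']
  rw [Nat.succ_eq_add_one, h2] at h1 ⊢
  exact h.append h1 (by simp)

/-- In the cyclic word `L`, the letter `y` is followed by the letter `z`. -/
def CycAdj (L : List (α × Bool)) (y z : α × Bool) : Prop :=
  ∃ p q, L = p ++ q ∧ (q ++ p).getLast? = some y ∧ (q ++ p).head? = some z

/-- The cyclic word `L` or its inverse takes the turn from `s` to the inverse of `t`. -/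
def Turn (L : List (α × Bool)) (s t : α × Bool) : Prop :=
  CycAdj L s (bar t) ∨ CycAdj L t (bar s)

/-- The graph of turns of `L` contains a cycle through four letters, which are all letters. -/
def FourCycle (L : List (α × Bool)) : Prop :=
  ∃ s₁ s₂ s₃ s₄ : α × Bool, [s₁, s₂, s₃, s₄].Nodup ∧ (∀ s, s ∈ [s₁, s₂, s₃, s₄]) ∧
    Turn L s₁ s₂ ∧ Turn L s₂ s₃ ∧ Turn L s₃ s₄ ∧ Turn L s₄ s₁

section Rotation

variable {p q l : List (α × Bool)} {y z : α × Bool}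

theorem mk_swap (p q : List (α × Bool)) :
    mk (q ++ p) = mk q * mk (p ++ q) * (mk q)⁻¹ := by
  rw [← mul_mk, ← mul_mk]
  group

theorem not_mem_zpowers_of_ne_nil (hL : IsCyclicallyReduced (p ++ q))
    (hy : (q ++ p).getLast? = some y) (hz : (q ++ p).head? = some z)
    (hyl : IsReduced (y :: l)) (hzl : IsReduced (bar z :: l)) (hl : l ≠ []) :
    (mk q)⁻¹ * mk l ∉ Subgroup.zpowers (mk (p ++ q)) := by
  intro hmem
  obtain ⟨j, hj⟩ := Subgroup.mem_zpowers_iff.1 hmem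
  have hq : IsReduced q := hL.isReduced.infix ⟨p, [], by simp⟩
  have hj' : mk (q ++ p) ^ (-j) * mk l = mk q := by
    rw [mk_swap, conj_zpow, zpow_neg, hj]
    group
  have hL' := hL.swap
  have hlen : 0 < l.length := List.length_pos_iff.2 hl
  rcases Int.eq_nat_or_neg (-j) with ⟨i, hi | hi⟩ <;> rw [hi] at hj' <;>
    rcases eq_or_ne i 0 with rfl | hi0
  · have hlq : l = q := IsReduced.eq_of_mk_eq (hyl.infix ⟨[y], [], by simp⟩) hq (by simpa using hj')
    subst hlq
    obtain ⟨s, l, rfl⟩ := List.exists_cons_of_ne_nil hl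
    simp only [List.cons_append, List.head?_cons, Option.some.injEq] at hz
    subst hz
    exact (isReduced_cons_cons_iff.1 hzl).1 rfl
  · rw [zpow_natCast, ← mk_flatten_replicate, mul_mk] at hj'
    have := congrArg List.length
      (IsReduced.eq_of_mk_eq (hL'.isReduced_flatten_append hy hyl hi0) hq hj')
    rw [List.length_append, length_flatten_replicate, List.length_append] at this
    nlinarith [Nat.pos_of_ne_zero hi0]
  · have hlq : l = q := IsReduced.eq_of_mk_eq (hyl.infix ⟨[y], [], by simp⟩) hq (by simpa using hj')
    subst hlq
    obtain ⟨s, l, rfl⟩ := List.exists_cons_of_ne_nil hl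
    simp only [List.cons_append, List.head?_cons, Option.some.injEq] at hz
    subst hz
    exact (isReduced_cons_cons_iff.1 hzl).1 rfl
  · rw [zpow_neg, ← inv_zpow, zpow_natCast, inv_mk, ← mk_flatten_replicate, mul_mk] at hj'
    have := congrArg List.length
      (IsReduced.eq_of_mk_eq (hL'.invRev.isReduced_flatten_append (getLast?_invRev hz) hzl hi0) hq
        hj')
    rw [List.length_append, length_flatten_replicate, invRev_length, List.length_append] at this
    nlinarith [Nat.pos_of_ne_zero hi0]

variable {X : Type*} {E : FreeGroup α → X}

theorem eq_of_not_mem_zpowers (hE : SplitsOrbit E (mk (p ++ q)))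
    (hL : IsCyclicallyReduced (p ++ q))
    (hy : (q ++ p).getLast? = some y) (hz : (q ++ p).head? = some z)
    (hR : ConeConst E (l.length + 1))
    (hyl : IsReduced (y :: l)) (hzl : IsReduced (bar z :: l))
    (hl : (mk q)⁻¹ * mk l ∉ Subgroup.zpowers (mk (p ++ q))) :
    E (mk (y :: l)) = E (mk (bar z :: l)) := by
  have hL' := hL.swap
  have hinj : Function.Injective fun k : ℤ => mk (q ++ p) ^ k := fun i j hij => by
    simp only [mk_swap p q, conj_zpow] at hij
    exact hE.zpow_injective (by simpa using hij)
  obtain ⟨k, hk, h1, h2⟩ := hE.exists_pow_mul_eq (mk q)⁻¹ (mk (q ++ p)) (mk l) hinj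
  have key : ∀ j : ℤ, E ((mk q)⁻¹ * (mk (q ++ p) ^ j * mk l)) = E ((mk q)⁻¹ * mk l) := fun j => by
    rw [← hE.zpow_mul_eq hl j, mk_swap p q, conj_zpow]
    group
  have h3 := key k
  have h4 := key (-k)
  rw [zpow_natCast, h1, hR.pow_mul hL' hy hyl hk] at h3
  rw [zpow_neg, ← inv_zpow, zpow_natCast, h2, inv_mk,
    hR.pow_mul hL'.invRev (getLast?_invRev hz) hzl hk] at h4
  rw [h3, h4]

end Rotation

section Whitehead

variable {X : Type*} {E : FreeGroup α → X} {L : List (α × Bool)}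

theorem ConeConst.of_succ (hL : IsCyclicallyReduced L) (hL0 : L ≠ [])
    (hE : SplitsOrbit E (mk L)) (hF : FourCycle L) {R : ℕ} (hR0 : R ≠ 0)
    (hR : ConeConst E (R + 1)) : ConeConst E R := by
  intro s l hsl hl
  rcases hl.lt_or_eq with hlt | rfl
  · exact hR s l hsl hlt
  obtain ⟨e, l, rfl⟩ := List.exists_cons_of_ne_nil (List.length_pos_iff.1 (Nat.pos_of_ne_zero hR0))
  have hred : ∀ t, t ≠ bar e → IsReduced (t :: e :: l) := fun t ht =>
    isReduced_cons_cons_iff.2 ⟨ht, (isReduced_cons_cons_iff.1 hsl).2⟩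
  have hadj : ∀ t u, t ≠ bar e → u ≠ bar e → CycAdj L t (bar u) →
      E (mk (t :: e :: l)) = E (mk (u :: e :: l)) := by
    rintro t u ht hu ⟨p, q, rfl, hy, hz⟩
    have hu' := hred u hu
    rw [← bar_bar u] at hu'
    rw [eq_of_not_mem_zpowers hE hL hy hz hR (hred t ht) hu'
      (not_mem_zpowers_of_ne_nil hL hy hz (hred t ht) hu' (by simp)), bar_bar]
  have hturn : ∀ t u, Turn L t u → t ≠ bar e → u ≠ bar e →
      E (mk (t :: e :: l)) = E (mk (u :: e :: l)) := by
    rintro t u (h | h) ht hu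
    · exact hadj t u ht hu h
    · exact (hadj u t hu ht h).symm
  have hall : ∀ t u, t ≠ bar e → u ≠ bar e → E (mk (t :: e :: l)) = E (mk (u :: e :: l)) := by
    obtain ⟨s₁, s₂, s₃, s₄, hnd, hc, h12, h23, h34, h41⟩ := hF
    have h12 := hturn _ _ h12
    have h23 := hturn _ _ h23
    have h34 := hturn _ _ h34
    have h41 := hturn _ _ h41
    generalize bar e = b at *
    simp only [List.nodup_cons, List.mem_cons, List.not_mem_nil, not_or, or_false] at hnd hc
    intro t u ht hu
    have ht' := hc t
    have hu' := hc u
    have hb' := hc b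
    grind
  have hone : ∀ t, t ≠ bar e → E (mk (t :: e :: l)) = E (mk (e :: l)) → 
      E (mk (s :: e :: l)) = E (mk (e :: l)) := fun t ht h =>
    (hall s t (isReduced_cons_cons_iff.1 hsl).1 ht).trans h
  have hel : IsReduced (e :: l) := (isReduced_cons_cons_iff.1 hsl).2
  obtain ⟨y, hy⟩ : ∃ y, L.getLast? = some y := ⟨_, List.getLast?_eq_some_getLast hL0⟩
  obtain ⟨z, hz⟩ : ∃ z, L.head? = some z := ⟨_, List.head?_eq_some_head hL0⟩
  by_cases hye : y = bar e
  · have hze : bar z ≠ bar e := by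
      intro h
      have hze : z = e := by rw [← bar_bar z, h, bar_bar]
      subst hze
      have := hL.2 y hy z hz
      rw [hye] at this
      simp [bar] at this
    refine hone (bar z) hze ?_
    rw [← hR.pow_mul hL.invRev (getLast?_invRev hz) (hred _ hze) one_ne_zero, pow_one, ← inv_mk,
      (hE.eq_iff _).2 (hel.mk_ne_one (by simp))]
  · refine hone y hye ?_
    rw [← hR.pow_mul hL hy (hred _ hye) one_ne_zero, pow_one,
      ← (hE.eq_iff (mk L * _)).2, inv_mul_cancel_left]
    have := hL.isReduced_flatten_append hy (hred _ hye) one_ne_zero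
    rw [mul_mk]
    exact (by simpa using this : IsReduced (L ++ e :: l)).mk_ne_one (by simp)

theorem not_coneConst_one (hL : IsCyclicallyReduced L) (hL0 : L ≠ [])
    (hE : SplitsOrbit E (mk L)) (hF : FourCycle L) : ¬ ConeConst E 1 := by
  intro hR
  obtain ⟨y, hy⟩ : ∃ y, L.getLast? = some y := ⟨_, List.getLast?_eq_some_getLast hL0⟩
  obtain ⟨z, hz⟩ : ∃ z, L.head? = some z := ⟨_, List.head?_eq_some_head hL0⟩
  have hyz : E (mk [y]) ≠ E (mk [bar z]) := by
    have h1 := hR.pow_mul (l := []) hL hy .singleton one_ne_zero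
    have h2 := hR.pow_mul (l := []) hL.invRev (getLast?_invRev hz) .singleton one_ne_zero
    have h3 := hE.pow_eq hE.pow_succ_ne_one 1
    rw [pow_one, ← one_eq_mk, mul_one] at h1 h2
    rw [pow_one] at h3
    rw [← h1, ← h2, h3, ← inv_mk]
    exact hE.inv_ne_one.symm
  have hadj : ∀ t u, CycAdj L t (bar u) → E (mk [t]) = E (mk [u]) ∨ (t = y ∧ u = bar z) := by
    rintro t u ⟨p, q, rfl, hy', hz'⟩
    by_cases hq : (mk q)⁻¹ * mk [] ∈ Subgroup.zpowers (mk (p ++ q))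
    · right
      rw [← one_eq_mk, mul_one, inv_mem_iff] at hq
      obtain ⟨j, hj⟩ := Subgroup.mem_zpowers_iff.1 hq
      have : mk (q ++ p) = mk (p ++ q) := by
        rw [mk_swap, ← hj]
        group
      rw [IsReduced.eq_of_mk_eq hL.swap.isReduced hL.isReduced this] at hy' hz'
      refine ⟨Option.some.inj (hy'.symm.trans hy), bar_eq_iff.1 (Option.some.inj (hz'.symm.trans hz))⟩
    · left
      rw [eq_of_not_mem_zpowers (l := []) hE hL hy' hz' hR .singleton .singleton hq, bar_bar]
  obtain ⟨s₁, s₂, s₃, s₄, hnd, hc, h12, h23, h34, h41⟩ := hF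
  have hturn : ∀ t u, Turn L t u → E (mk [t]) = E (mk [u]) ∨ (t = y ∧ u = bar z) ∨
      (u = y ∧ t = bar z) := by
    rintro t u (h | h)
    · rcases hadj t u h with h | h <;> simp [h]
    · rcases hadj u t h with h | h <;> simp [h]
  have h12 := hturn _ _ h12
  have h23 := hturn _ _ h23
  have h34 := hturn _ _ h34
  have h41 := hturn _ _ h41
  have hcy := hc y
  have hcz := hc (bar z)
  generalize bar z = b at *
  simp only [List.nodup_cons, List.mem_cons, List.not_mem_nil, not_or, or_false] at hnd hcy hcz
  clear hadj hturn hR hE hc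
  grind

theorem not_fourCycle [Finite α] (hL : IsCyclicallyReduced L) (hL0 : L ≠ [])
    (hE : SplitsOrbit E (mk L)) : ¬ FourCycle L := by
  intro hF
  obtain ⟨R, hR⟩ := exists_coneConst hE.finite
  refine not_coneConst_one hL hL0 hE hF ?_
  induction R with
  | zero => exact fun s l h _ => hR s l h (Nat.zero_le _)
  | succ R ih =>
    rcases eq_or_ne R 0 with rfl | hR0
    · exact hR
    · exact ih (hR.of_succ hL hL0 hE hF hR0)

end Whitehead

end FreeGroup

namespace FreeGroup

section CyclicWord

variable {α : Type*} {L : List (α × Bool)}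

theorem CycAdj.ne_bar (hL : IsCyclicallyReduced L) {y z : α × Bool} (h : CycAdj L y z) :
    z ≠ bar y := by
  obtain ⟨p, q, rfl, hy, hz⟩ := h
  rintro rfl
  have := hL.swap.2 y hy _ hz
  simp [bar] at this

theorem isChain_cycAdj_suffix (p q : List (α × Bool)) : q.IsChain (CycAdj (p ++ q)) := by
  induction q generalizing p with
  | nil => exact .nil
  | cons x q ih =>
    have h := ih (p ++ [x])
    rw [List.append_assoc, List.singleton_append] at h
    cases q with
    | nil => exact .singleton x
    | cons y q =>
      refine .cons_cons ⟨p ++ [x], y :: q, by simp, ?_, by simp⟩ h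
      rw [← List.append_assoc, List.getLast?_concat]

theorem isChain_cycAdj (p q : List (α × Bool)) : (q ++ p).IsChain (CycAdj (p ++ q)) := by
  have h := isChain_cycAdj_suffix [] (p ++ q)
  rw [List.nil_append, List.isChain_append] at h
  refine List.isChain_append.2 ⟨h.2.1, h.1, fun x hx y hy => ⟨[], p ++ q, rfl, ?_, ?_⟩⟩
  · rw [List.append_nil, List.getLast?_append_of_ne_nil _ (by rintro rfl; simp at hx), hx]
  · rw [List.append_nil, List.head?_append_of_ne_nil _ (by rintro rfl; simp at hy), hy]

theorem forall_mem_of_cycAdj {P : α × Bool → Prop} (hP : ∀ y z, CycAdj L y z → P y → P z)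
    {s : α × Bool} (hs : s ∈ L) (hPs : P s) : ∀ t ∈ L, P t := by
  obtain ⟨u, v, rfl⟩ := List.append_of_mem hs
  intro t ht
  refine (isChain_cycAdj u (s :: v)).induction P _ hP (fun _ => hPs) t ?_
  simp only [List.mem_append, List.mem_cons] at ht ⊢
  tauto

end CyclicWord

theorem mem_letters {s t : Fin 2 × Bool} (h : s.1 ≠ t.1) (u : Fin 2 × Bool) :
    u = s ∨ u = bar s ∨ u = t ∨ u = bar t := by
  revert s t u
  decide

theorem forall_mem_pair_of_not_turn {L : List (Fin 2 × Bool)} (hL : IsCyclicallyReduced L)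
    {s t : Fin 2 × Bool} (hst : s.1 ≠ t.1) (h : ¬ Turn L s t) :
    (∀ u ∈ L, u = s ∨ u = t) ∨ ∀ u ∈ L, u = bar s ∨ u = bar t := by
  by_cases hex : ∃ u ∈ L, u = s ∨ u = t
  · obtain ⟨u, hu, hu'⟩ := hex
    refine .inl (forall_mem_of_cycAdj ?_ hu hu')
    rintro y z hyz (rfl | rfl)
    · rcases mem_letters hst z with rfl | rfl | rfl | rfl
      · simp
      · exact absurd rfl (hyz.ne_bar hL)
      · simp
      · exact absurd (.inl hyz) h
    · rcases mem_letters hst z with rfl | rfl | rfl | rfl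
      · simp
      · exact absurd (.inr hyz) h
      · simp
      · exact absurd rfl (hyz.ne_bar hL)
  · refine .inr fun u hu => ?_
    rcases mem_letters hst u with rfl | rfl | rfl | rfl
    · exact absurd ⟨_, hu, .inl rfl⟩ hex
    · simp
    · exact absurd ⟨_, hu, .inr rfl⟩ hex
    · simp

theorem exists_not_cycAdj_of_not_fourCycle {L : List (Fin 2 × Bool)} (hL : IsCyclicallyReduced L)
    (hF : ¬ FourCycle L) (hgen : ∀ i, ∃ s ∈ L, s.1 ≠ i) :
    ∃ s t : Fin 2 × Bool, s.1 ≠ t.1 ∧ (∀ u ∈ L, u = s ∨ u = t) ∧ ¬ CycAdj L t t := by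
  have hpair : ∃ s t : Fin 2 × Bool, s.1 ≠ t.1 ∧ ∀ u ∈ L, u = s ∨ u = t := by
    by_contra! hno
    have hturn : ∀ s t : Fin 2 × Bool, s.1 ≠ t.1 → Turn L s t := fun s t hst => by
      by_contra h
      rcases forall_mem_pair_of_not_turn hL hst h with h | h
      · obtain ⟨u, hu, h1, h2⟩ := hno s t hst
        exact (h u hu).elim h1 h2
      · obtain ⟨u, hu, h1, h2⟩ := hno (bar s) (bar t) hst
        exact (h u hu).elim h1 h2
    exact hF ⟨(0, true), (1, true), (0, false), (1, false), by decide, by decide,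
      hturn _ _ (by decide), hturn _ _ (by decide), hturn _ _ (by decide), hturn _ _ (by decide)⟩
  obtain ⟨s, t, hst, hsub⟩ := hpair
  by_contra! hno
  have hs : s ∈ L := by
    obtain ⟨u, hu, hut⟩ := hgen t.1
    rcases hsub u hu with rfl | rfl
    · exact hu
    · exact absurd rfl hut
  have ht : t ∈ L := by
    obtain ⟨u, hu, hus⟩ := hgen s.1
    rcases hsub u hu with rfl | rfl
    · exact absurd rfl hus
    · exact hu
  have hmem : ∀ {y z}, CycAdj L y z → z ∈ L := by
    rintro y z ⟨p, q, rfl, -, hz⟩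
    have := List.mem_of_mem_head? hz
    simp only [List.mem_append] at this ⊢
    tauto
  have hcross : ∀ s t : Fin 2 × Bool, s.1 ≠ t.1 → (∀ u ∈ L, u = s ∨ u = t) → s ∈ L → t ∈ L →
      CycAdj L s t := by
    intro s t hst hsub hs ht
    by_contra hadj
    have := forall_mem_of_cycAdj (P := (· = s)) (fun y z hyz hy => by
      subst hy
      rcases hsub z (hmem hyz) with rfl | rfl
      · rfl
      · exact absurd hyz hadj) hs rfl t ht
    exact hst (by rw [this])
  have hs_s : CycAdj L s s := hno t s hst.symm fun u hu => (hsub u hu).symm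
  have ht_t : CycAdj L t t := hno s t hst hsub
  have hs_t : CycAdj L s t := hcross s t hst hsub hs ht
  have ht_s : CycAdj L t s := hcross t s hst.symm (fun u hu => (hsub u hu).symm) ht hs
  refine hF ⟨s, bar s, t, bar t, ?_, fun u => ?_, ?_, ?_, ?_, ?_⟩
  · revert hst
    clear * -
    revert s t
    decide
  · simpa using mem_letters hst u
  · exact .inl (by rwa [bar_bar])
  · exact .inr (by rwa [bar_bar])
  · exact .inl (by rwa [bar_bar])
  · exact .inr (by rwa [bar_bar])

theorem mk_singleton_eq {α : Type*} (s : α × Bool) : mk [s] = if s.2 then of s.1 else (of s.1)⁻¹ := by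
  obtain ⟨i, ⟨⟩ | ⟨⟩⟩ := s <;> rfl

theorem mk_bar {α : Type*} (s : α × Bool) : mk [bar s] = (mk [s])⁻¹ := by
  simp [invRev, bar]

section Shear

variable {α : Type*} [DecidableEq α]

/-- The endomorphism sending the letter `t` to `t s⁻¹` and fixing the other generators. -/
def shearHom (s t : α × Bool) : FreeGroup α →* FreeGroup α :=
  lift fun i => if i = t.1 then (if t.2 then of i * (mk [s])⁻¹ else mk [s] * of i) else of i

theorem shearHom_of_ne (s t : α × Bool) {i : α} (h : i ≠ t.1) : shearHom s t (of i) = of i := by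
  simp [shearHom, h]

theorem shearHom_mk_right (s t : α × Bool) : shearHom s t (mk [t]) = mk [t] * (mk [s])⁻¹ := by
  obtain ⟨i, ⟨⟩ | ⟨⟩⟩ := t <;> simp [mk_singleton_eq (i, _), shearHom]

theorem shearHom_mk_of_ne (s t : α × Bool) {u : α × Bool} (h : u.1 ≠ t.1) :
    shearHom s t (mk [u]) = mk [u] := by
  rw [mk_singleton_eq]
  split_ifs <;> simp [shearHom_of_ne s t h]

theorem shearHom_comp (s t : α × Bool) (h : s.1 ≠ t.1) :
    (shearHom (bar s) t).comp (shearHom s t) = MonoidHom.id _ := by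
  ext i
  rcases eq_or_ne i t.1 with rfl | hi
  · suffices shearHom (bar s) t (shearHom s t (mk [t])) = mk [t] by
      rw [mk_singleton_eq] at this
      split_ifs at this
      · exact this
      · simpa using this
    have h' : (bar s).1 ≠ t.1 := h
    rw [shearHom_mk_right, _root_.map_mul, shearHom_mk_right, _root_.map_inv, shearHom_mk_of_ne _ _ h, mk_bar]
    group
  · simp [shearHom_of_ne _ _ hi]

/-- The automorphism sending the letter `t` to `t s⁻¹` and fixing the other generators. -/
def shear (s t : α × Bool) (h : s.1 ≠ t.1) : FreeGroup α ≃* FreeGroup α :=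
  MonoidHom.toMulEquiv (shearHom s t) (shearHom (bar s) t) (shearHom_comp s t h) (by
    simpa only [bar_bar] using shearHom_comp (bar s) t h)

theorem exists_shearHom_mk_eq {s t : α × Bool} (hst : s.1 ≠ t.1) :
    ∀ M : List (α × Bool), (∀ u ∈ M, u = s ∨ u = t) → M.IsChain (fun y z => ¬ (y = t ∧ z = t)) →
      M.getLast? ≠ some t → ∃ N, shearHom s t (mk M) = mk N ∧ N.length + M.count t = M.length
  | [], _, _, _ => ⟨[], rfl, rfl⟩
  | [x], hsub, _, hlast => by
    have hx : x = s := (hsub x (by simp)).resolve_right (by simpa using hlast)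
    subst hx
    have : x ≠ t := fun h => hst (by rw [h])
    exact ⟨[x], shearHom_mk_of_ne _ _ hst, by simp [this]⟩
  | x :: y :: M, hsub, hchain, hlast => by
    have hs : s ≠ t := fun h => hst (by rw [h])
    rw [List.isChain_cons_cons] at hchain
    rw [List.getLast?_cons_cons] at hlast
    rcases hsub x (by simp) with rfl | rfl
    · obtain ⟨N, hN, hlen⟩ := exists_shearHom_mk_eq hst (y :: M)
        (fun u hu => hsub u (List.mem_cons_of_mem _ hu)) hchain.2 hlast
      refine ⟨x :: N, ?_, ?_⟩
      · rw [← List.singleton_append, ← mul_mk, _root_.map_mul, hN, shearHom_mk_of_ne _ _ hst, mul_mk]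
        rfl
      · rw [List.count_cons_of_ne hs]
        simp only [List.length_cons] at hlen ⊢
        lia
    · have hy : y = s := (hsub y (by simp)).resolve_right fun h => hchain.1 ⟨rfl, h⟩
      subst hy
      have hlast' : M.getLast? ≠ some x := by
        cases M with
        | nil => simp
        | cons z M => rwa [List.getLast?_cons_cons] at hlast
      obtain ⟨N, hN, hlen⟩ := exists_shearHom_mk_eq hst M
        (fun u hu => hsub u (by simp [hu])) hchain.2.tail hlast'
      refine ⟨x :: N, ?_, ?_⟩
      · rw [← List.singleton_append, ← mul_mk, ← List.singleton_append (l := M), ← mul_mk, _root_.map_mul,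
          _root_.map_mul, hN, shearHom_mk_of_ne _ _ hst, shearHom_mk_right, ← mul_assoc,
          inv_mul_cancel_right, mul_mk]
        rfl
      · rw [List.count_cons_self, List.count_cons_of_ne hs]
        simp only [List.length_cons]
        lia

end Shear

/-- `c` is part of a pair of generators. -/
def HasComp {G : Type*} [Group G] (c : G) : Prop := ∃ y, Subgroup.closure {c, y} = ⊤

theorem HasComp.map {G H : Type*} [Group G] [Group H] {c : G} (h : HasComp c) (φ : G ≃* H) :
    HasComp (φ c) := by
  obtain ⟨y, hy⟩ := h
  refine ⟨φ y, ?_⟩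
  have := congrArg (Subgroup.map (φ : G →* H)) hy
  rwa [MonoidHom.map_closure, Subgroup.map_equiv_top, Set.image_pair] at this

/-- Some `E` splits the orbit of `c`. -/
def HasCut {G : Type*} [Group G] (c : G) : Prop := ∃ E : G → ℤˣ, SplitsOrbit E c

theorem HasCut.map {G H : Type*} [Group G] [Group H] {c : G} (h : HasCut c) (φ : G ≃* H) :
    HasCut (φ c) := by
  obtain ⟨E, hE⟩ := h
  exact ⟨_, hE.comp_mulEquiv φ.symm⟩

theorem mk_mem_zpowers_of {α : Type*} (i : α) :
    ∀ L : List (α × Bool), (∀ s ∈ L, s.1 = i) → mk L ∈ Subgroup.zpowers (of i)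
  | [], _ => one_mem _
  | s :: L, h => by
    rw [← List.singleton_append, ← mul_mk]
    refine mul_mem ?_ (mk_mem_zpowers_of i L fun t ht => h t (List.mem_cons_of_mem _ ht))
    obtain rfl := h s (by simp)
    obtain ⟨i, ⟨⟩ | ⟨⟩⟩ := s
    · exact inv_mem (Subgroup.mem_zpowers _)
    · exact Subgroup.mem_zpowers _

theorem HasCut.hasComp_of_mem_zpowers {c : FreeGroup (Fin 2)} (h : HasCut c) {i : Fin 2}
    (hc : c ∈ Subgroup.zpowers (of i)) : HasComp c := by
  obtain ⟨E, hE⟩ := h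
  obtain ⟨k, hk⟩ := Subgroup.mem_zpowers_iff.1 hc
  have hi : of i ∈ Subgroup.zpowers c := hE.mem_zpowers_of_conj (k := 1) (m := 1) one_ne_zero (by
    rw [← hk]
    group)
  refine ⟨of (1 - i), ?_⟩
  rw [eq_top_iff, ← closure_range_of, Subgroup.closure_le]
  rintro _ ⟨j, rfl⟩
  have hj : j = i ∨ j = 1 - i := by lia
  rcases hj with rfl | rfl
  · exact (Subgroup.zpowers_le.2 (Subgroup.subset_closure (by simp))) hi
  · exact Subgroup.subset_closure (by simp)

theorem HasCut.hasComp_mk (n : ℕ) : ∀ L : List (Fin 2 × Bool), L.length = n → HasCut (mk L) →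
    HasComp (mk L) := by
  induction n using Nat.strong_induction_on with
  | _ n ih =>
  suffices ∀ L : List (Fin 2 × Bool), L.length ≤ n → IsCyclicallyReduced L → HasCut (mk L) →
      HasComp (mk L) by
    intro L hLn hL
    set M := reduceCyclically (reduce L) with hM
    set K := reduceCyclically.conjugator (reduce L) with hK
    have hconj : mk L = MulAut.conj (mk K) (mk M) := by
      rw [← reduce.self, ← reduceCyclically.conj_conjugator_reduceCyclically (reduce L), MulAut.conj_apply]
      simp only [← mul_mk, inv_mk, hM, hK]
    have hlen : M.length ≤ n := by
      have h1 := congrArg List.length (reduceCyclically.conj_conjugator_reduceCyclically (reduce L))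
      have h2 := norm_mk_le (L₁ := L)
      rw [norm, toWord_mk] at h2
      simp only [List.length_append] at h1
      lia
    have hMc : HasCut (mk M) := by
      have := hL.map (MulAut.conj (mk K)).symm
      rwa [hconj, MulEquiv.symm_apply_apply] at this
    rw [hconj]
    exact (this M hlen (reduceCyclically.isCyclicallyReduced
      (isReduced_iff_reduce_eq.2 reduce.idem)) hMc).map _
  intro L hLn hL hcut
  by_cases hgen : ∀ i, ∃ s ∈ L, s.1 ≠ i
  · have hL0 : L ≠ [] := by
      rintro rfl
      obtain ⟨s, hs, -⟩ := hgen 0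
      exact List.not_mem_nil hs
    obtain ⟨E, hE⟩ := hcut
    obtain ⟨s, t, hst, hsub, htt⟩ :=
      exists_not_cycAdj_of_not_fourCycle hL (not_fourCycle hL hL0 hE) hgen
    have hs : s ∈ L := by
      obtain ⟨u, hu, hut⟩ := hgen t.1
      rcases hsub u hu with rfl | rfl
      · exact hu
      · exact absurd rfl hut
    have ht : t ∈ L := by
      obtain ⟨u, hu, hus⟩ := hgen s.1
      rcases hsub u hu with rfl | rfl
      · exact absurd rfl hus
      · exact hu
    obtain ⟨u, v, rfl⟩ := List.append_of_mem hs
    have hst' : s ≠ t := fun h => hst (by rw [h])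
    have hperm : (v ++ (u ++ [s])).Perm (u ++ s :: v) := by
      simpa using List.perm_append_comm (l₁ := v) (l₂ := u ++ [s])
    have hchain := isChain_cycAdj (u ++ [s]) v
    rw [List.append_assoc, List.singleton_append] at hchain
    obtain ⟨N, hN, hlen⟩ := exists_shearHom_mk_eq hst (v ++ (u ++ [s]))
      (fun x hx => hsub x (hperm.mem_iff.1 hx))
      (hchain.imp fun y z hyz hyzt => htt (by rwa [hyzt.1, hyzt.2] at hyz))
      (by rw [← List.append_assoc, List.getLast?_concat]; simpa using hst')
    rw [hperm.count_eq, hperm.length_eq] at hlen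
    have hcount := List.count_pos_iff.2 ht
    set φ := (MulAut.conj (mk v)).trans (shear s t hst) with hφ
    have hφN : φ (mk (u ++ s :: v)) = mk N := by
      rw [← hN, hφ, MulEquiv.trans_apply, MulAut.conj_apply, mk_swap (u ++ [s]) v, List.append_assoc,
        List.singleton_append]
      rfl
    have hcut' := HasCut.map ⟨E, hE⟩ φ
    rw [hφN] at hcut'
    have := (ih N.length (by lia) N rfl hcut').map φ.symm
    rwa [← hφN, MulEquiv.symm_apply_apply] at this
  · push Not at hgen
    obtain ⟨i, hi⟩ := hgen
    exact hcut.hasComp_of_mem_zpowers (mk_mem_zpowers_of i L hi)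

/-- An element of the free group of rank two whose orbit is split is primitive. -/
theorem HasCut.hasComp {c : FreeGroup (Fin 2)} (h : HasCut c) : HasComp c := by
  rw [← mk_toWord (x := c)] at h ⊢
  exact hasComp_mk _ _ rfl h

end FreeGroup

section Rank

theorem Subgroup.monoidHom_ext_of_sup_eq_top {G H : Type*} [Group G] [Group H] {A B : Subgroup G}
    (h : A ⊔ B = ⊤) {f g : G →* H} (hA : ∀ a ∈ A, f a = g a) (hB : ∀ b ∈ B, f b = g b) : f = g := by
  have hle : A ⊔ B ≤ f.eqLocus g := sup_le hA hB
  rw [h] at hle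
  exact MonoidHom.ext fun x => hle (Subgroup.mem_top x)

theorem card_monoidHom_units (G : Type*) [Group G] [IsFreeGroup G] :
    Nat.card (G →* ℤˣ) = Nat.card (IsFreeGroup.Generators G → ℤˣ) :=
  Nat.card_congr IsFreeGroup.lift.symm

theorem HasAmalgamLift.card_mul_dvd {G : Type} [Group G] {A B : Subgroup G}
    (h : HasAmalgamLift A B) (hAB : A ⊔ B = ⊤) {c : G} (hc : A ⊓ B = Subgroup.zpowers c) :
    ∃ k, k ∣ 2 ∧ Nat.card (A →* ℤˣ) * Nat.card (B →* ℤˣ) = Nat.card (G →* ℤˣ) * k := by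
  have hcmem : c ∈ A ⊓ B := hc ▸ Subgroup.mem_zpowers c
  obtain ⟨hcA, hcB⟩ := hcmem
  let χ : (A →* ℤˣ) × (B →* ℤˣ) →* ℤˣ :=
    ((MonoidHom.eval (⟨c, hcA⟩ : A)).comp (MonoidHom.fst _ _)) *
      ((MonoidHom.eval (⟨c, hcB⟩ : B)).comp (MonoidHom.snd _ _))
  let r (f : G →* ℤˣ) : χ.ker := ⟨(f.comp A.subtype, f.comp B.subtype), by
    simp [χ, MonoidHom.mem_ker, Int.units_mul_self]⟩
  have hr : Function.Bijective r := by
    refine ⟨fun f g hfg => ?_, ?_⟩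
    · simp only [r, Subtype.mk.injEq, Prod.mk.injEq] at hfg
      exact Subgroup.monoidHom_ext_of_sup_eq_top hAB
        (fun a ha => DFunLike.congr_fun hfg.1 ⟨a, ha⟩) (fun b hb => DFunLike.congr_fun hfg.2 ⟨b, hb⟩)
    · rintro ⟨⟨f, g⟩, hfg⟩
      have hcc : f ⟨c, hcA⟩ = g ⟨c, hcB⟩ := by
        have : f ⟨c, hcA⟩ * g ⟨c, hcB⟩ = 1 := hfg
        rw [eq_inv_of_mul_eq_one_left this, Int.units_inv_eq_self]
      obtain ⟨k, hkA, hkB⟩ := h ℤˣ f g fun x ha hb => by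
        have hx : x ∈ A ⊓ B := ⟨ha, hb⟩
        rw [hc] at hx
        obtain ⟨j, rfl⟩ := Subgroup.mem_zpowers_iff.1 hx
        have h1 : (⟨c ^ j, ha⟩ : A) = ⟨c, hcA⟩ ^ j := rfl
        have h2 : (⟨c ^ j, hb⟩ : B) = ⟨c, hcB⟩ ^ j := rfl
        rw [h1, h2, map_zpow, map_zpow, hcc]
      exact ⟨k, Subtype.ext (Prod.ext (MonoidHom.ext hkA) (MonoidHom.ext hkB))⟩
  refine ⟨χ.ker.index, ?_, ?_⟩
  · rw [Subgroup.index_ker]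
    exact (Subgroup.card_subgroup_dvd_card _).trans (by simp)
  · rw [← Nat.card_prod, Nat.card_congr (Equiv.ofBijective r hr), Subgroup.card_mul_index]

theorem HasAmalgamLift.card_generators {A B : Subgroup (FreeGroup (Fin 2))}
    (h : HasAmalgamLift A B) (hAB : A ⊔ B = ⊤) {c : FreeGroup (Fin 2)}
    (hc : A ⊓ B = Subgroup.zpowers c) :
    Finite (IsFreeGroup.Generators A) ∧ Finite (IsFreeGroup.Generators B) ∧
      Nat.card (IsFreeGroup.Generators A) + Nat.card (IsFreeGroup.Generators B) ≤ 3 := by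
  obtain ⟨k, hk, hcard⟩ := h.card_mul_dvd hAB hc
  have hF : Nat.card (FreeGroup (Fin 2) →* ℤˣ) = 4 := by
    rw [Nat.card_congr FreeGroup.lift.symm]
    simp
  have hk2 : k ≤ 2 := Nat.le_of_dvd two_pos hk
  have hk0 : k ≠ 0 := by
    rintro rfl
    simp at hk
  rw [hF, card_monoidHom_units, card_monoidHom_units] at hcard
  have hpos : Nat.card (IsFreeGroup.Generators A → ℤˣ) *
      Nat.card (IsFreeGroup.Generators B → ℤˣ) ≠ 0 := by
    lia
  have hfin : ∀ X : Type, Nat.card (X → ℤˣ) ≠ 0 → Finite X := fun X hX => by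
    by_contra hinf
    rw [not_finite_iff_infinite] at hinf
    have : Nontrivial ℤˣ := ⟨1, -1, by decide⟩
    have : Infinite (X → ℤˣ) := Function.infinite_of_left
    exact hX Nat.card_eq_zero_of_infinite
  have hA := hfin _ (left_ne_zero_of_mul hpos)
  have hB := hfin _ (right_ne_zero_of_mul hpos)
  refine ⟨hA, hB, ?_⟩
  rw [Nat.card_fun, Nat.card_fun, ← pow_add, show Nat.card ℤˣ = 2 by simp] at hcard
  by_contra! hlt
  have := Nat.pow_le_pow_right two_pos hlt
  lia

end Rank

section Factors

open FreeGroup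

theorem IsFreeGroup.mem_zpowers_of_unique (G : Type*) [Group G] [IsFreeGroup G]
    [Unique (IsFreeGroup.Generators G)] (g : G) :
    g ∈ Subgroup.zpowers (IsFreeGroup.of (G := G) default) := by
  obtain ⟨w, rfl⟩ := (IsFreeGroup.mulEquiv G).surjective g
  have h := mk_mem_zpowers_of default w.toWord fun s _ => Subsingleton.elim _ _
  rw [mk_toWord] at h
  obtain ⟨k, hk⟩ := Subgroup.mem_zpowers_iff.1 h
  refine Subgroup.mem_zpowers_iff.2 ⟨k, ?_⟩
  rw [← hk, map_zpow]
  rfl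

theorem HasAmalgamLift.exists_basis {A B : Subgroup (FreeGroup (Fin 2))}
    (h : HasAmalgamLift A B) (hAB : A ⊔ B = ⊤) (hA : A ≠ A ⊓ B) (hB : B ≠ A ⊓ B)
    {c : FreeGroup (Fin 2)} (hc1 : c ≠ 1) (hc : A ⊓ B = Subgroup.zpowers c)
    (hcardA : Nat.card (IsFreeGroup.Generators A) = 1)
    (hcardB : Nat.card (IsFreeGroup.Generators B) = 1 ∨
      Nat.card (IsFreeGroup.Generators B) = 2) :
    ∃ (x y : FreeGroup (Fin 2)) (n : ℕ), 1 < n ∧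
      Subgroup.closure {x, y} = ⊤ ∧
      A ⊓ B = Subgroup.zpowers (x ^ n) ∧
      A = Subgroup.zpowers x ∧ B = Subgroup.closure {x ^ n, y} ∧
      IsMalnormalIn (Subgroup.zpowers (x ^ n)) (Subgroup.closure {x ^ n, y}) := by
  obtain ⟨_, ⟨i⟩⟩ := Nat.card_eq_one_iff_unique.1 hcardA
  have : Unique (IsFreeGroup.Generators A) := uniqueOfSubsingleton i
  set x : A := IsFreeGroup.of default with hx
  have hAx : A = Subgroup.zpowers (x : FreeGroup (Fin 2)) := by
    refine le_antisymm (fun a ha => ?_) (Subgroup.zpowers_le.2 x.2)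
    obtain ⟨k, hk⟩ := Subgroup.mem_zpowers_iff.1 (IsFreeGroup.mem_zpowers_of_unique A ⟨a, ha⟩)
    exact Subgroup.mem_zpowers_iff.2 ⟨k, congrArg Subtype.val hk⟩
  have hcA : c ∈ A := (hc ▸ Subgroup.mem_zpowers c : c ∈ A ⊓ B).1
  rw [hAx] at hcA
  obtain ⟨k, hk⟩ := Subgroup.mem_zpowers_iff.1 hcA
  set n := k.natAbs with hn
  have hcn : A ⊓ B = Subgroup.zpowers ((x : FreeGroup (Fin 2)) ^ n) := by
    rw [hc, ← hk]
    rcases Int.natAbs_eq k with h | h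
    · rw [h, zpow_natCast]
    · rw [h, zpow_neg, Subgroup.zpowers_inv, zpow_natCast]
  have hn0 : n ≠ 0 := fun h0 => hc1 (by rw [← hk, Int.natAbs_eq_zero.1 h0, zpow_zero])
  have hn1 : n ≠ 1 := fun h1 => hA (by rw [hcn, h1, pow_one, ← hAx])
  have hnlt : 1 < n := by lia
  have hcmem : (x : FreeGroup (Fin 2)) ^ n ∈ A ⊓ B := hcn ▸ Subgroup.mem_zpowers _
  have hxn1 : (x : FreeGroup (Fin 2)) ^ n ≠ 1 := fun h1 => hc1 (by
    rw [← Subgroup.zpowers_eq_bot, ← hc, hcn, h1, Subgroup.zpowers_one_eq_bot])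
  obtain ⟨E, hE⟩ := exists_splitsOrbit h x
    (fun H _ σ => ⟨IsFreeGroup.lift fun _ => σ, IsFreeGroup.lift_of _ _⟩)
    ⟨(x : FreeGroup (Fin 2)) ^ n, hcmem.2⟩
    (fun k hk => hxn1 ((pow_eq_one_iff_left (Nat.succ_ne_zero k)).1 (congrArg Subtype.val hk)))
    n hnlt rfl hcn
  set d : B := ⟨(x : FreeGroup (Fin 2)) ^ n, hcmem.2⟩ with hd
  have hcomp : HasComp d := by
    rcases hcardB with h1 | h2
    · obtain ⟨_, ⟨i⟩⟩ := Nat.card_eq_one_iff_unique.1 h1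
      have : Unique (IsFreeGroup.Generators B) := uniqueOfSubsingleton i
      obtain ⟨j, hj⟩ := Subgroup.mem_zpowers_iff.1 (IsFreeGroup.mem_zpowers_of_unique B d)
      have hy := hE.mem_zpowers_of_conj (k := 1) (m := 1)
        (g := IsFreeGroup.of (default : IsFreeGroup.Generators B)) one_ne_zero (by
          rw [← hj]
          group)
      refine absurd (le_antisymm (fun b hb => ?_) inf_le_right) hB
      obtain ⟨i, hi⟩ := Subgroup.mem_zpowers_iff.1
        (Subgroup.zpowers_le.2 hy (IsFreeGroup.mem_zpowers_of_unique B ⟨b, hb⟩))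
      rw [hcn]
      exact Subgroup.mem_zpowers_iff.2 ⟨i, congrArg Subtype.val hi⟩
    · have : Finite (IsFreeGroup.Generators B) := Nat.finite_of_card_ne_zero (by lia)
      let e : IsFreeGroup.Generators B ≃ Fin 2 := Finite.equivFinOfCardEq h2
      let φ : B ≃* FreeGroup (Fin 2) := (IsFreeGroup.mulEquiv B).symm.trans (freeGroupCongr e)
      have := (HasCut.map ⟨E, hE⟩ φ).hasComp.map φ.symm
      rwa [MulEquiv.symm_apply_apply] at this
  obtain ⟨y, hy⟩ := hcomp
  have hBy : B = Subgroup.closure {(x : FreeGroup (Fin 2)) ^ n, (y : FreeGroup (Fin 2))} := by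
    have := congrArg (Subgroup.map B.subtype) hy
    rw [MonoidHom.map_closure, Set.image_pair, ← MonoidHom.range_eq_map, Subgroup.range_subtype]
      at this
    exact this.symm
  refine ⟨x, y, n, hnlt, ?_, hcn, hAx, hBy, ?_⟩
  · rw [eq_top_iff, ← hAB, sup_le_iff]
    constructor
    · refine hAx.trans_le (Subgroup.zpowers_le.2 ?_)
      exact Subgroup.subset_closure (by simp)
    · refine hBy.trans_le ((Subgroup.closure_le _).2 ?_)
      rintro _ (rfl | rfl)
      · exact pow_mem (Subgroup.subset_closure (by simp)) n
      · exact Subgroup.subset_closure (by simp)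
  · rw [← hBy]
    have hmem : ∀ b : B, b ∈ Subgroup.zpowers d ↔
        (b : FreeGroup (Fin 2)) ∈ Subgroup.zpowers ((x : FreeGroup (Fin 2)) ^ n) := fun b => by
      simp only [Subgroup.mem_zpowers_iff, Subtype.ext_iff]
      rfl
    intro g hg hgC b hb hgb
    have hbB : b ∈ B := (hcn ▸ hb : b ∈ A ⊓ B).2
    exact congrArg Subtype.val (hE.isMalnormalIn_aux (g := ⟨g, hg⟩) (d := ⟨b, hbB⟩)
      (mt (hmem _).1 hgC) ((hmem _).2 hb) ((hmem _).2 hgb))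

theorem IsFreeGroup.card_generators_ne_zero {G : Type*} [Group G] [IsFreeGroup G]
    [Finite (IsFreeGroup.Generators G)] {g : G} (hg : g ≠ 1) :
    Nat.card (IsFreeGroup.Generators G) ≠ 0 := by
  intro h
  have := Finite.card_eq_zero_iff.1 h
  exact hg ((IsFreeGroup.mulEquiv G).symm.injective (Subsingleton.elim _ _))

theorem SplitsAsAmalgam.hasAmalgamLift {G : Type} [Group G] {A B : Subgroup G}
    (h : SplitsAsAmalgam A B) : HasAmalgamLift A B := by
  intro H _ f g hfg
  let e := MulEquiv.ofBijective (amalgToGroup A B) h.2.2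
  let φ : ∀ b, amalgFam A B b →* H := fun b => match b with
    | true => f
    | false => g
  have hφ : ∀ b, (φ b).comp (amalgMaps A B b) = f.comp (Subgroup.inclusion inf_le_left) := by
    rintro (_ | _)
    · ext x
      exact (hfg x x.2.1 x.2.2).symm
    · rfl
  let k := (Monoid.PushoutI.lift φ _ hφ).comp e.symm.toMonoidHom
  have hk : ∀ b (a : amalgFam A B b), k a = φ b a := fun b a => by
    have : e (Monoid.PushoutI.of b a) = (a : G) := by
      simp only [e, MulEquiv.ofBijective_apply, amalgToGroup, Monoid.PushoutI.lift_of]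
      rfl
    rw [← this]
    simp [k]
  exact ⟨k, hk true, hk false⟩

theorem SplitsAsAmalgam.sup_eq_top {G : Type} [Group G] {A B : Subgroup G}
    (h : SplitsAsAmalgam A B) : A ⊔ B = ⊤ := by
  rw [eq_top_iff]
  intro g _
  obtain ⟨w, rfl⟩ := h.2.2.2 g
  induction w using Monoid.PushoutI.induction_on with
  | of b a =>
    rw [amalgToGroup, Monoid.PushoutI.lift_of]
    cases b
    · exact Subgroup.mem_sup_right a.2
    · exact Subgroup.mem_sup_left a.2
  | base a =>
    rw [amalgToGroup, Monoid.PushoutI.lift_base]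
    exact Subgroup.mem_sup_left a.2.1
  | mul u v hu hv =>
    rw [_root_.map_mul]
    exact mul_mem (hu trivial) (hv trivial)

end Factors


/-- If `F₂` splits as a proper amalgamated product `A ∗_C B` with `C` infinite cyclic, then
for some basis `{x, y}` of `F₂` and some `n > 1`, up to exchanging the factors,
`A = ⟨x⟩`, `B = ⟨xⁿ, y⟩` and `C = ⟨xⁿ⟩`; in particular `C` is malnormal in `B`. -/
theorem amalgam_splitting_of_freeGroup (A B : Subgroup (FreeGroup (Fin 2)))
    (hsplit : SplitsAsAmalgam A B)
    (hC : ∃ c : FreeGroup (Fin 2), c ≠ 1 ∧ A ⊓ B = Subgroup.zpowers c) :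
    ∃ (x y : FreeGroup (Fin 2)) (n : ℕ), 1 < n ∧
      Subgroup.closure {x, y} = ⊤ ∧
      A ⊓ B = Subgroup.zpowers (x ^ n) ∧
      ((A = Subgroup.zpowers x ∧ B = Subgroup.closure {x ^ n, y}) ∨
        (B = Subgroup.zpowers x ∧ A = Subgroup.closure {x ^ n, y})) ∧
      IsMalnormalIn (Subgroup.zpowers (x ^ n)) (Subgroup.closure {x ^ n, y}) := by
  obtain ⟨c, hc1, hc⟩ := hC
  have hlift := hsplit.hasAmalgamLift
  have hsup := hsplit.sup_eq_top
  obtain ⟨hA, hB, -⟩ := hsplit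
  obtain ⟨_, _, hcard⟩ := hlift.card_generators hsup hc
  have hcAB : c ∈ A ⊓ B := hc ▸ Subgroup.mem_zpowers c
  have hposA := IsFreeGroup.card_generators_ne_zero (g := (⟨c, hcAB.1⟩ : A))
    fun h => hc1 (congrArg Subtype.val h)
  have hposB := IsFreeGroup.card_generators_ne_zero (g := (⟨c, hcAB.2⟩ : B))
    fun h => hc1 (congrArg Subtype.val h)
  by_cases h1 : Nat.card (IsFreeGroup.Generators A) = 1
  · obtain ⟨x, y, n, hn, hxy, hx, hAx, hBy, hmal⟩ :=
      hlift.exists_basis hsup hA hB hc1 hc h1 (by lia)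
    exact ⟨x, y, n, hn, hxy, hx, .inl ⟨hAx, hBy⟩, hmal⟩
  · rw [inf_comm] at hA hB hc ⊢
    rw [sup_comm] at hsup
    obtain ⟨x, y, n, hn, hxy, hx, hBx, hAy, hmal⟩ :=
      hlift.symm.exists_basis hsup hB hA hc1 hc (by lia) (by lia)
    exact ⟨x, y, n, hn, hxy, hx, .inr ⟨hBx, hAy⟩, hmal⟩
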